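/- arXiv:1006.0116 — 2 statements merged into one kernel-verified Lean document; each statement's English description precedes it below -/
import Mathlib

section
/- Suppose p ≡ −1 (mod 3). For every integer j with (2p−1)/3 ≤ j ≤ p−2, the lead monomial (graded reverse lexicographic order with a0 < a1 < a2 < a3) of tr_B^G(N^j · tr^P(a3^{(5p−7)/3 − j} a2²)) equals a3^{pj} a2^{(7p−5)/3 − 2j} a1^{j − (2p−4)/3}. -/
open MvPolynomial

noncomputable section

/-- The right action of the 2×2 matrix `g` over `F_p` on `F[V] = F[a₃,a₂,a₁,a₀]`
(with `aᵢ = X i`), given by the dual of the third symmetric power representation. -/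
def act (p : ℕ) [Fact p.Prime] (F : Type) [Field F] [CharP F p]
    (g : Matrix (Fin 2) (Fin 2) (ZMod p)) :
    MvPolynomial (Fin 4) F →ₐ[F] MvPolynomial (Fin 4) F :=
  letI c : ZMod p → MvPolynomial (Fin 4) F := fun x => C (ZMod.castHom (dvd_refl p) F x)
  letI al := c (g 0 0)
  letI be := c (g 0 1)
  letI ga := c (g 1 0)
  letI de := c (g 1 1)
  aeval ![
    de ^ 3 * X 0 + 3 * de ^ 2 * ga * X 1 + 3 * de * ga ^ 2 * X 2 + ga ^ 3 * X 3,
    de ^ 2 * be * X 0 + (de ^ 2 * al + 2 * de * be * ga) * X 1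
      + (2 * de * ga * al + be * ga ^ 2) * X 2 + ga ^ 2 * al * X 3,
    de * be ^ 2 * X 0 + (2 * de * be * al + be ^ 2 * ga) * X 1
      + (de * al ^ 2 + 2 * be * ga * al) * X 2 + ga * al ^ 2 * X 3,
    be ^ 3 * X 0 + 3 * be ^ 2 * al * X 1 + 3 * be * al ^ 2 * X 2 + al ^ 3 * X 3]

/-- The transfer with respect to the Sylow `p`-subgroup `P = ⟨σ⟩`,
`tr^P(f) = ∑_{τ ∈ P} (f)τ`, where the elements of `P` are the matrices `[[1,s],[0,1]]`. -/
def trP (p : ℕ) [Fact p.Prime] (F : Type) [Field F] [CharP F p]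
    (f : MvPolynomial (Fin 4) F) : MvPolynomial (Fin 4) F :=
  ∑ s : ZMod p, act p F !![1, s; 0, 1] f

/-- The relative transfer `tr_B^G(f) = ∑_{τ ∈ Q ∪ {η}} (f)τ`, using the coset
representatives `Q ∪ {η}` of the Borel subgroup `B` in `G = SL₂(F_p)`. -/
def trBG (p : ℕ) [Fact p.Prime] (F : Type) [Field F] [CharP F p]
    (f : MvPolynomial (Fin 4) F) : MvPolynomial (Fin 4) F :=
  (∑ s : ZMod p, act p F !![1, 0; s, 1] f) + act p F !![0, 1; -1, 0] f

/-- The full transfer `tr^G(f) = ∑_{τ ∈ SL₂(F_p)} (f)τ`. -/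
def trG (p : ℕ) [Fact p.Prime] (F : Type) [Field F] [CharP F p]
    (f : MvPolynomial (Fin 4) F) : MvPolynomial (Fin 4) F :=
  ∑ g : Matrix.SpecialLinearGroup (Fin 2) (ZMod p), act p F g.1 f

/-- `N = ∏_{τ ∈ P} (a₃)τ = ∏_{s ∈ F_p} (a₃ + 3s a₂ + 3s² a₁ + s³ a₀)`. -/
def Npoly (p : ℕ) [Fact p.Prime] (F : Type) [Field F] [CharP F p] :
    MvPolynomial (Fin 4) F :=
  ∏ s : ZMod p, act p F !![1, s; 0, 1] (X 3)

/-- The weight of the monomial `a₃^e₃ a₂^e₂ a₁^e₁ a₀^e₀`, i.e. `3e₃ + e₂ - e₁ - 3e₀`. -/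
def wt (d : Fin 4 →₀ ℕ) : ℤ :=
  3 * (d 3 : ℤ) + (d 2 : ℤ) - (d 1 : ℤ) - 3 * (d 0 : ℤ)

/-- `f` is isobaric of weight `lam` modulo `p - 1`: every monomial occurring in `f`
has weight congruent to `lam` modulo `p - 1`. -/
def Isobaric (p : ℕ) {F : Type} [Field F] (f : MvPolynomial (Fin 4) F) (lam : ℤ) : Prop :=
  ∀ d ∈ f.support, ((p : ℤ) - 1) ∣ (wt d - lam)

/-- Strict grevlex comparison on exponent vectors, for the graded reverse
lexicographic order with `a₀ < a₁ < a₂ < a₃`. -/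
def grevlexLt (d e : Fin 4 →₀ ℕ) : Prop :=
  (∑ i : Fin 4, d i) < (∑ i : Fin 4, e i) ∨
    ((∑ i : Fin 4, d i) = (∑ i : Fin 4, e i) ∧
      ∃ k : Fin 4, e k < d k ∧ ∀ j : Fin 4, j < k → d j = e j)

/-- `d` is the lead monomial of `f` in the grevlex order with `a₀ < a₁ < a₂ < a₃`. -/
def LeadMonomialIs {F : Type} [Field F] (f : MvPolynomial (Fin 4) F) (d : Fin 4 →₀ ℕ) : Prop :=
  coeff d f ≠ 0 ∧ ∀ e ∈ f.support, e ≠ d → grevlexLt e d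

/-- The lead term of `f` is `c · x^d` in the grevlex order with `a₀ < a₁ < a₂ < a₃`. -/
def LeadTermIs {F : Type} [Field F] (f : MvPolynomial (Fin 4) F) (c : F) (d : Fin 4 →₀ ℕ) :
    Prop :=
  LeadMonomialIs f d ∧ coeff d f = c

/-- The discriminant `D` of the binary cubic. -/
def Dpoly (F : Type) [Field F] : MvPolynomial (Fin 4) F :=
  3 * X 2 ^ 2 * X 1 ^ 2 - 4 * X 3 * X 1 ^ 3 - 4 * X 2 ^ 3 * X 0
    + 6 * X 3 * X 2 * X 1 * X 0 - X 3 ^ 2 * X 0 ^ 2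

/-- `K = -tr^G(a₁^{p-1})`. -/
def Kpoly (p : ℕ) [Fact p.Prime] (F : Type) [Field F] [CharP F p] :
    MvPolynomial (Fin 4) F :=
  - trG p F (X 1 ^ (p - 1))

/-- Dickson's invariant `L = 3(a₂^p a₁ - a₂ a₁^p) - (a₃^p a₀ - a₃ a₀^p)`. -/
def Lpoly (p : ℕ) (F : Type) [Field F] : MvPolynomial (Fin 4) F :=
  3 * (X 2 ^ p * X 1 - X 2 * X 1 ^ p) - (X 3 ^ p * X 0 - X 3 * X 0 ^ p)

/-- `e = 2a₁³ + a₀(a₃a₀ - 3a₂a₁)`. -/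
def epoly (F : Type) [Field F] : MvPolynomial (Fin 4) F :=
  2 * X 1 ^ 3 + X 0 * (X 3 * X 0 - 3 * X 2 * X 1)

/-- `d = a₁² - a₂a₀`. -/
def dpoly (F : Type) [Field F] : MvPolynomial (Fin 4) F :=
  X 1 ^ 2 - X 2 * X 0

/-- `ξ = 3a₂² - 4a₃a₁`. -/
def xipoly (F : Type) [Field F] : MvPolynomial (Fin 4) F :=
  3 * X 2 ^ 2 - 4 * X 3 * X 1

/-- The ring of `SL₂(F_p)`-invariants `F[V]^{SL₂(F_p)}`, as a subalgebra of `F[V]`. -/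
def invariants (p : ℕ) [Fact p.Prime] (F : Type) [Field F] [CharP F p] :
    Subalgebra F (MvPolynomial (Fin 4) F) where
  carrier := {f | ∀ g : Matrix.SpecialLinearGroup (Fin 2) (ZMod p), act p F g.1 f = f}
  mul_mem' := fun hf hg g => by rw [map_mul, hf g, hg g]
  one_mem' := fun g => map_one _
  add_mem' := fun hf hg g => by rw [map_add, hf g, hg g]
  zero_mem' := fun g => map_zero _
  algebraMap_mem' := fun c g => (act _ _ _).commutes c

lemma aux_S {p : ℕ} [Fact p.Prime] {R : Type} [CommRing R] (c : ZMod p →+* R)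
    (m b n i : ℕ) (hmb : m + b = p - 1) (him : i ≤ m) (hbn : b ≤ n) (x y : R)
    (hy : y ^ (b + 1) = 0) :
    ∑ t : ZMod p, c t ^ i * (c t * y + x) ^ n
      = if i = m then - ((n.choose b : R) * y ^ b * x ^ (n - b)) else 0 := by
  have h1 : ∀ t : ZMod p, c t ^ i * (c t * y + x) ^ n =
      ∑ l ∈ Finset.range (n + 1), c (t ^ (i + l)) * (y ^ l * x ^ (n - l) * (n.choose l : R)) := by
    intro t
    rw [add_pow, Finset.mul_sum]
    refine Finset.sum_congr rfl fun l _ => ?_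
    rw [map_pow, pow_add, mul_pow]; ring
  simp_rw [h1]
  rw [Finset.sum_comm]
  simp_rw [← Finset.sum_mul, ← map_sum]
  have hp2 := (Fact.out : p.Prime).two_le
  have hlt : ∀ k, k < p - 1 → ∑ t : ZMod p, t ^ k = 0 := by
    intro k hk
    apply FiniteField.sum_pow_lt_card_sub_one
    rwa [ZMod.card]
  have hz : ∀ l, b < l → y ^ l = 0 := by
    intro l hl
    exact pow_eq_zero_of_le hl hy
  split_ifs with h
  · subst h
    rw [Finset.sum_eq_single b]
    · rw [hmb]
      have : ∑ t : ZMod p, t ^ (p - 1) = -1 := by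
        have h0 : ∀ t : ZMod p, t ^ (p - 1) = 1 - if t = 0 then 1 else 0 := by
          intro t
          split_ifs with ht
          · subst ht; rw [zero_pow (by omega)]; simp
          · rw [ZMod.pow_card_sub_one_eq_one ht]; simp
        simp_rw [h0]
        simp
      rw [this]; simp only [map_neg, map_one]; ring
    · intro l _ hl
      rcases lt_or_gt_of_ne hl with h' | h'
      · rw [hlt _ (by omega)]; simp
      · rw [hz l h']; simp
    · intro h'; simp at h'; omega
  · apply Finset.sum_eq_zero
    intro l _
    rcases le_or_gt l b with h' | h'
    · rw [hlt _ (by omega)]; simp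
    · rw [hz l h']; simp

lemma aux_T {p : ℕ} [Fact p.Prime] {R : Type} [CommRing R] (c : ZMod p →+* R)
    (m b : ℕ) (hmb : m + b = p - 1) (hb : b ≤ m) (x y z : R)
    (hy : y ^ (b + 1) = 0) :
    ∑ t : ZMod p, (z + 3 * c t * x + 3 * c t ^ 2 * y) ^ m * (x + 2 * c t * y) ^ 2
      = - (3 ^ m * (4 * ((m + 2).choose b : R) - 4 * ((m + 1).choose b : R) + (m.choose b : R)))
        * y ^ b * x ^ (m + 2 - b) := by
  have h1 : ∀ t : ZMod p,
      (z + 3 * c t * x + 3 * c t ^ 2 * y) ^ m * (x + 2 * c t * y) ^ 2 =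
      ∑ i ∈ Finset.range (m + 1), 3 ^ i * z ^ (m - i) * (m.choose i : R) *
        (4 * (c t ^ i * (c t * y + x) ^ (i + 2)) - 4 * x * (c t ^ i * (c t * y + x) ^ (i + 1))
          + x ^ 2 * (c t ^ i * (c t * y + x) ^ i)) := by
    intro t
    have : z + 3 * c t * x + 3 * c t ^ 2 * y = 3 * c t * (c t * y + x) + z := by ring
    rw [this, add_pow, Finset.sum_mul]
    refine Finset.sum_congr rfl fun i _ => ?_
    rw [mul_pow, mul_pow]; ring
  simp_rw [h1]
  rw [Finset.sum_comm, Finset.sum_eq_single m]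
  · simp_rw [← Finset.mul_sum, Finset.sum_add_distrib, Finset.sum_sub_distrib, ← Finset.mul_sum]
    rw [aux_S c m b (m+2) m hmb le_rfl (by omega) x y hy,
      aux_S c m b (m+1) m hmb le_rfl (by omega) x y hy,
      aux_S c m b m m hmb le_rfl (by omega) x y hy]
    obtain ⟨k, rfl⟩ := Nat.exists_eq_add_of_le hb
    rw [show b + k + 2 - b = k + 2 by omega, show b + k + 1 - b = k + 1 by omega,
      show b + k - b = k by omega]
    simp only [if_true, Nat.sub_self, pow_zero, Nat.choose_self, Nat.cast_one]
    ring
  · intro i hi him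
    simp only [Finset.mem_range] at hi
    simp_rw [← Finset.mul_sum, Finset.sum_add_distrib, Finset.sum_sub_distrib, ← Finset.mul_sum]
    have key : ∀ n, ∑ t : ZMod p, c t ^ i * (c t * y + x) ^ n = 0 := by
      intro n
      by_cases hn : b ≤ n
      · rw [aux_S c m b n i hmb (by omega) hn x y hy, if_neg him]
      · have h2 : ∀ t : ZMod p, c t ^ i * (c t * y + x) ^ n =
            ∑ l ∈ Finset.range (n + 1),
              c (t ^ (i + l)) * (y ^ l * x ^ (n - l) * (n.choose l : R)) := by
          intro t
          rw [add_pow, Finset.mul_sum]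
          refine Finset.sum_congr rfl fun l _ => ?_
          rw [map_pow, pow_add, mul_pow]; ring
        simp_rw [h2]
        rw [Finset.sum_comm]
        simp_rw [← Finset.sum_mul, ← map_sum]
        apply Finset.sum_eq_zero
        intro l hl
        simp only [Finset.mem_range] at hl
        have hlt : ∑ t : ZMod p, t ^ (i + l) = 0 := by
          apply FiniteField.sum_pow_lt_card_sub_one
          rw [ZMod.card]; omega
        rw [hlt]; simp
    rw [key, key, key]; simp
  · intro h; simp at h

lemma aux_c {p : ℕ} [Fact p.Prime] (hp : 3 < p) (F : Type) [Field F] [CharP F p]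
    (m b : ℕ) (hmb : m + b = p - 1) (hb : b ≤ m) (hm : m ≤ p - 2) :
    - ((3 : F) ^ m * (4 * ((m + 2).choose b : F) - 4 * ((m + 1).choose b : F) + (m.choose b : F)))
      ≠ 0 := by
  have hpp := (Fact.out : p.Prime)
  have hnd : ∀ n : ℕ, ¬ p ∣ n → (n : F) ≠ 0 := fun n h h' => h ((CharP.cast_eq_zero_iff F p n).1 h')
  have h3 : (3 : F) ≠ 0 := by
    have := hnd 3 (Nat.not_dvd_of_pos_of_lt (by norm_num) hp)
    exact_mod_cast this
  have hC : (m.choose b : F) ≠ 0 := by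
    apply hnd
    intro h
    have h1 : p ∣ m.factorial := by
      rw [← Nat.choose_mul_factorial_mul_factorial hb, mul_assoc]
      exact Dvd.dvd.mul_right h _
    rw [hpp.dvd_factorial] at h1
    omega
  have hbF : (b : F) = -1 - m := by
    have : ((m + b + 1 : ℕ) : F) = 0 := by
      rw [show m + b + 1 = p by omega]; exact CharP.cast_eq_zero F p
    push_cast at this
    linear_combination this
  have e1 := Nat.choose_mul_succ_eq m b
  have e2 := Nat.choose_mul_succ_eq (m + 1) b
  have f1 : (m.choose b : F) * (m + 1) = (m + 1).choose b * (2 * m + 2) := by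
    have := congrArg (Nat.cast : ℕ → F) e1
    rw [Nat.cast_mul, Nat.cast_mul, Nat.cast_sub (by omega), hbF] at this
    push_cast at this
    linear_combination this
  have f2 : ((m + 1).choose b : F) * (m + 2) = (m + 2).choose b * (2 * m + 3) := by
    have := congrArg (Nat.cast : ℕ → F) e2
    rw [Nat.cast_mul, Nat.cast_mul, Nat.cast_sub (by omega), hbF] at this
    push_cast at this
    linear_combination this
  have hm1 : (m : F) + 1 ≠ 0 := by
    have := hnd (m + 1) (Nat.not_dvd_of_pos_of_lt (by omega) (by omega))
    exact_mod_cast this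
  have f1' : (m.choose b : F) = 2 * (m + 1).choose b := by
    apply mul_right_cancel₀ hm1
    linear_combination f1
  rw [neg_ne_zero]
  apply mul_ne_zero (pow_ne_zero _ h3)
  intro h
  apply hC
  have : (2 * m + 3 : F) * (4 * ((m + 2).choose b : F) - 4 * ((m + 1).choose b : F)
      + (m.choose b : F)) = m.choose b := by
    linear_combination (-4 : F) * f2 + (2 * m + 2 : F) * f1'
  rw [h, mul_zero] at this
  exact this.symm

/-- scalar embedding -/
def cc (p : ℕ) [Fact p.Prime] (F : Type) [Field F] [CharP F p] :
    ZMod p →+* MvPolynomial (Fin 4) F := C.comp (ZMod.castHom (dvd_refl p) F)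

lemma cc_apply (p : ℕ) [Fact p.Prime] (F : Type) [Field F] [CharP F p] (t : ZMod p) :
    C (ZMod.castHom (dvd_refl p) F t) = cc p F t := rfl

section
variable (p : ℕ) [Fact p.Prime] (F : Type) [Field F] [CharP F p]

lemma act_X (g : Matrix (Fin 2) (Fin 2) (ZMod p)) :
    act p F g (X 0) = cc p F (g 1 1) ^ 3 * X 0 + 3 * cc p F (g 1 1) ^ 2 * cc p F (g 1 0) * X 1
      + 3 * cc p F (g 1 1) * cc p F (g 1 0) ^ 2 * X 2 + cc p F (g 1 0) ^ 3 * X 3 ∧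
    act p F g (X 1) = cc p F (g 1 1) ^ 2 * cc p F (g 0 1) * X 0
      + (cc p F (g 1 1) ^ 2 * cc p F (g 0 0)
          + 2 * cc p F (g 1 1) * cc p F (g 0 1) * cc p F (g 1 0)) * X 1
      + (2 * cc p F (g 1 1) * cc p F (g 1 0) * cc p F (g 0 0)
          + cc p F (g 0 1) * cc p F (g 1 0) ^ 2) * X 2
      + cc p F (g 1 0) ^ 2 * cc p F (g 0 0) * X 3 ∧
    act p F g (X 2) = cc p F (g 1 1) * cc p F (g 0 1) ^ 2 * X 0
      + (2 * cc p F (g 1 1) * cc p F (g 0 1) * cc p F (g 0 0)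
          + cc p F (g 0 1) ^ 2 * cc p F (g 1 0)) * X 1
      + (cc p F (g 1 1) * cc p F (g 0 0) ^ 2
          + 2 * cc p F (g 0 1) * cc p F (g 1 0) * cc p F (g 0 0)) * X 2
      + cc p F (g 1 0) * cc p F (g 0 0) ^ 2 * X 3 ∧
    act p F g (X 3) = cc p F (g 0 1) ^ 3 * X 0 + 3 * cc p F (g 0 1) ^ 2 * cc p F (g 0 0) * X 1
      + 3 * cc p F (g 0 1) * cc p F (g 0 0) ^ 2 * X 2 + cc p F (g 0 0) ^ 3 * X 3 := by
  refine ⟨?_, ?_, ?_, ?_⟩ <;> · unfold act; rw [aeval_X]; rfl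

lemma act_cc (g : Matrix (Fin 2) (Fin 2) (ZMod p)) (t : ZMod p) :
    act p F g (cc p F t) = cc p F t := (act p F g).commutes _

lemma act_sig3 (s : ZMod p) : act p F !![1, s; 0, 1] (X 3) =
    X 3 + 3 * cc p F s * X 2 + 3 * cc p F s ^ 2 * X 1 + cc p F s ^ 3 * X 0 := by
  rw [(act_X p F _).2.2.2]; simp; ring

lemma act_sig2 (s : ZMod p) : act p F !![1, s; 0, 1] (X 2) =
    X 2 + 2 * cc p F s * X 1 + cc p F s ^ 2 * X 0 := by
  rw [(act_X p F _).2.2.1]; simp; ring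

lemma act_one (f : MvPolynomial (Fin 4) F) : act p F !![1, 0; 0, 1] f = f := by
  have : act p F !![1, 0; 0, 1] = AlgHom.id F _ := by
    apply MvPolynomial.algHom_ext
    intro i
    have h := act_X p F !![1, 0; 0, 1]
    fin_cases i
    · exact h.1.trans (by simp)
    · exact h.2.1.trans (by simp)
    · exact h.2.2.1.trans (by simp)
    · exact h.2.2.2.trans (by simp)
  rw [this]; rfl

lemma dvd_low (s : ZMod p) (hs : s ≠ 0) : X 0 ∣ act p F !![1, 0; s, 1] (Npoly p F) := by
  unfold Npoly
  rw [map_prod]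
  refine Dvd.dvd.trans ?_ (Finset.dvd_prod_of_mem _ (Finset.mem_univ (-s⁻¹)))
  rw [act_sig3]
  simp only [map_add, map_mul, map_pow, act_cc, map_ofNat, (act_X p F _).1, (act_X p F _).2.1,
    (act_X p F _).2.2.1, (act_X p F _).2.2.2]
  simp only [Matrix.of_apply, Matrix.cons_val_zero, Matrix.cons_val_one, Matrix.cons_val', 
    Matrix.cons_val_fin_one, map_one, map_zero, map_neg]
  have h : cc p F s⁻¹ * cc p F s = 1 := by rw [← map_mul, inv_mul_cancel₀ hs, map_one]
  refine ⟨-cc p F s⁻¹ ^ 3, ?_⟩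
  generalize cc p F s⁻¹ = u at *
  generalize cc p F s = v at *
  have h2 : u ^ 2 * v ^ 2 = 1 := by rw [← mul_pow, h, one_pow]
  have h3 : u ^ 3 * v ^ 3 = 1 := by rw [← mul_pow, h, one_pow]
  have h4 : u ^ 2 * v  = u := by linear_combination u * h
  have h5 : u ^ 3 * v  = u ^ 2 := by linear_combination u ^ 2 * h
  have h6 : u ^ 3 * v ^ 2 = u := by linear_combination u * h2
  ring_nf
  linear_combination (-3 * X 3 : MvPolynomial (Fin 4) F) * h + 3 * X 3 * h2 - X 3 * h3
    + 12 * X 2 * h4 - 9 * X 2 * h4 - 3 * X 2 * h6 + 3 * X 2 * h4 - 3 * X 1 * h5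

lemma dvd_eta : X 0 ∣ act p F !![0, 1; -1, 0] (Npoly p F) := by
  unfold Npoly
  rw [map_prod]
  refine Dvd.dvd.trans ?_ (Finset.dvd_prod_of_mem _ (Finset.mem_univ 0))
  rw [act_sig3]
  simp [(act_X p F _).2.2.2]

lemma trBG_mod (j : ℕ) (hj : j ≠ 0) (T : MvPolynomial (Fin 4) F) :
    X 0 ∣ trBG p F (Npoly p F ^ j * T) - Npoly p F ^ j * T := by
  unfold trBG
  rw [← Finset.add_sum_erase _ _ (Finset.mem_univ (0 : ZMod p)), act_one]
  rw [show ∀ a b c : MvPolynomial (Fin 4) F, a + b + c - a = b + c by intros; ring]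
  apply dvd_add
  · apply Finset.dvd_sum
    intro s hs
    rw [map_mul, map_pow]
    exact Dvd.dvd.mul_right ((dvd_low p F s (Finset.ne_of_mem_erase hs)).trans
      (dvd_pow_self _ hj)) _
  · rw [map_mul, map_pow]
    exact Dvd.dvd.mul_right ((dvd_eta p F).trans (dvd_pow_self _ hj)) _

lemma N_mod (j : ℕ) : ∃ U : Fin 3 → MvPolynomial (Fin 4) F,
    Npoly p F ^ j = X 3 ^ (p * j) + (X 0 * U 0 + X 1 * U 1 + X 2 * U 2) := by
  let I : Ideal (MvPolynomial (Fin 4) F) := Ideal.span {X 0, X 1, X 2}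
  have h0 : Ideal.Quotient.mk I (X 0) = 0 :=
    Ideal.Quotient.eq_zero_iff_mem.2 (Ideal.subset_span (by simp))
  have h1 : Ideal.Quotient.mk I (X 1) = 0 :=
    Ideal.Quotient.eq_zero_iff_mem.2 (Ideal.subset_span (by simp))
  have h2 : Ideal.Quotient.mk I (X 2) = 0 :=
    Ideal.Quotient.eq_zero_iff_mem.2 (Ideal.subset_span (by simp))
  have : Npoly p F ^ j - X 3 ^ (p * j) ∈ I := by
    rw [← Ideal.Quotient.eq]
    unfold Npoly
    simp_rw [act_sig3]
    simp [h0, h1, h2, pow_mul, ZMod.card]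
  rw [Ideal.mem_span_insert] at this
  obtain ⟨a, w, hw, h⟩ := this
  rw [Ideal.mem_span_pair] at hw
  obtain ⟨b, c, hw⟩ := hw
  refine ⟨![a, b, c], ?_⟩
  simp only [Matrix.cons_val_zero, Matrix.cons_val_one, Matrix.cons_val]
  linear_combination h - hw

lemma T_mod (m b : ℕ) (hmb : m + b = p - 1) (hb : b ≤ m) :
    ∃ Q R : MvPolynomial (Fin 4) F, trP p F (X 3 ^ m * X 2 ^ 2) =
      C (- ((3 : F) ^ m * (4 * ((m + 2).choose b : F) - 4 * ((m + 1).choose b : F)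
        + (m.choose b : F)))) * X 1 ^ b * X 2 ^ (m + 2 - b) + X 0 * Q + X 1 ^ (b + 1) * R := by
  let I : Ideal (MvPolynomial (Fin 4) F) := Ideal.span {X 0, X 1 ^ (b + 1)}
  have h0 : Ideal.Quotient.mk I (X 0) = 0 :=
    Ideal.Quotient.eq_zero_iff_mem.2 (Ideal.subset_span (by simp))
  have h1 : Ideal.Quotient.mk I (X 1) ^ (b + 1) = 0 := by
    rw [← map_pow]
    exact Ideal.Quotient.eq_zero_iff_mem.2 (Ideal.subset_span (by simp))
  have : trP p F (X 3 ^ m * X 2 ^ 2) -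
      C (- ((3 : F) ^ m * (4 * ((m + 2).choose b : F) - 4 * ((m + 1).choose b : F)
        + (m.choose b : F)))) * X 1 ^ b * X 2 ^ (m + 2 - b) ∈ I := by
    rw [← Ideal.Quotient.eq]
    unfold trP
    simp_rw [map_mul, map_pow, act_sig3, act_sig2]
    have := aux_T ((Ideal.Quotient.mk I).comp (cc p F)) m b hmb hb (Ideal.Quotient.mk I (X 2))
      (Ideal.Quotient.mk I (X 1)) (Ideal.Quotient.mk I (X 3)) h1
    simp only [map_sum, map_mul, map_pow, map_add, map_sub, map_neg, h0, mul_zero, add_zero,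
      map_ofNat, map_natCast, RingHom.comp_apply] at this ⊢
    exact this
  rw [Ideal.mem_span_pair] at this
  obtain ⟨a, c, h⟩ := this
  exact ⟨a, c, by linear_combination -h⟩

lemma act_hom (g : Matrix (Fin 2) (Fin 2) (ZMod p)) {f : MvPolynomial (Fin 4) F} {n : ℕ}
    (hf : f.IsHomogeneous n) : (act p F g f).IsHomogeneous n := by
  have hX : ∀ i, (act p F g (X i)).IsHomogeneous 1 := by
    have hc : ∀ t, (cc p F t).IsHomogeneous 0 := fun t => isHomogeneous_C _ _
    have h2 : (2 : MvPolynomial (Fin 4) F).IsHomogeneous 0 := isHomogeneous_C _ (2 : F)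
    have h3 : (3 : MvPolynomial (Fin 4) F).IsHomogeneous 0 := isHomogeneous_C _ (3 : F)
    have hm : ∀ {a b : MvPolynomial (Fin 4) F}, a.IsHomogeneous 0 → b.IsHomogeneous 0 →
      (a * b).IsHomogeneous 0 := fun ha hb => ha.mul hb
    have hpw : ∀ {a : MvPolynomial (Fin 4) F} (k : ℕ), a.IsHomogeneous 0 →
      (a ^ k).IsHomogeneous 0 := fun k ha => by simpa using ha.pow k
    have hx : ∀ {a : MvPolynomial (Fin 4) F} (i : Fin 4), a.IsHomogeneous 0 →
      (a * X i).IsHomogeneous 1 := fun i ha => by simpa using ha.mul (isHomogeneous_X F i)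
    have H := act_X p F g
    have k1 := hc (g 0 0)
    have k2 := hc (g 0 1)
    have k3 := hc (g 1 0)
    have k4 := hc (g 1 1)
    clear hc
    generalize cc p F (g 0 0) = al at *
    generalize cc p F (g 0 1) = be at *
    generalize cc p F (g 1 0) = ga at *
    generalize cc p F (g 1 1) = de at *
    generalize (2 : MvPolynomial (Fin 4) F) = two at *
    generalize (3 : MvPolynomial (Fin 4) F) = three at *
    intro i
    fin_cases i
    · refine (congrArg (fun q => IsHomogeneous q 1) H.1).mpr ?_
      refine ((IsHomogeneous.add (hx _ ?_) (hx _ ?_)).add (hx _ ?_)).add (hx _ ?_) <;>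
      repeat' first | assumption | apply hm | apply hpw
    · refine (congrArg (fun q => IsHomogeneous q 1) H.2.1).mpr ?_
      refine ((IsHomogeneous.add (hx _ ?_) (hx _ (.add ?_ ?_))).add (hx _ (.add ?_ ?_))).add
        (hx _ ?_) <;>
      repeat' first | assumption | apply hm | apply hpw
    · refine (congrArg (fun q => IsHomogeneous q 1) H.2.2.1).mpr ?_
      refine ((IsHomogeneous.add (hx _ ?_) (hx _ (.add ?_ ?_))).add (hx _ (.add ?_ ?_))).add
        (hx _ ?_) <;>
      repeat' first | assumption | apply hm | apply hpw
    · refine (congrArg (fun q => IsHomogeneous q 1) H.2.2.2).mpr ?_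
      refine ((IsHomogeneous.add (hx _ ?_) (hx _ ?_)).add (hx _ ?_)).add (hx _ ?_) <;>
      repeat' first | assumption | apply hm | apply hpw
  have h := hf.aeval (fun i => act p F g (X i)) hX
  rw [one_mul] at h
  have e : aeval (fun i => act p F g (X i)) = act p F g := by
    apply MvPolynomial.algHom_ext; intro i; simp
  rwa [e] at h

lemma big_hom (j m : ℕ) :
    (trBG p F (Npoly p F ^ j * trP p F (X 3 ^ m * X 2 ^ 2))).IsHomogeneous (p * j + (m + 2)) := by
  have h1 : (Npoly p F).IsHomogeneous p := by
    have := IsHomogeneous.prod Finset.univ (fun s : ZMod p => act p F !![1, s; 0, 1] (X 3))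
      (fun _ => 1) (fun s _ => act_hom p F _ (isHomogeneous_X F 3))
    simpa [ZMod.card, Npoly] using this
  have h2 : (trP p F (X 3 ^ m * X 2 ^ 2)).IsHomogeneous (m + 2) := by
    apply IsHomogeneous.sum
    intro s _
    apply act_hom
    exact (isHomogeneous_X_pow _ _).mul (isHomogeneous_X_pow _ _)
  have h3 := (h1.pow j).mul h2
  exact (IsHomogeneous.sum _ _ _ fun s _ => act_hom p F _ h3).add (act_hom p F _ h3)

end

lemma coeff_mono_mul {F : Type} [Field F] (e : Fin 4 →₀ ℕ) (i : Fin 4) (k : ℕ)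
    (f : MvPolynomial (Fin 4) F) (h : e i < k) : coeff e (X i ^ k * f) = 0 := by
  rw [X_pow_eq_monomial, coeff_monomial_mul', if_neg]
  intro h'
  have := h' i
  simp at this
  omega

lemma lead_of {F : Type} [Field F] (f Q W U : MvPolynomial (Fin 4) F) (c : F) (hc : c ≠ 0)
    (A b n : ℕ)
    (hf : f.IsHomogeneous (n + A + b))
    (h : f = X 0 * Q + X 1 ^ (b + 1) * W + X 1 ^ b * (X 2 ^ (A + 1) * U)
      + C c * X 1 ^ b * X 2 ^ A * X 3 ^ n) :
    LeadMonomialIs f (Finsupp.single 3 n + Finsupp.single 2 A + Finsupp.single 1 b) := by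
  set d : Fin 4 →₀ ℕ := Finsupp.single 3 n + Finsupp.single 2 A + Finsupp.single 1 b with hd
  have d0 : d 0 = 0 := by simp [hd]
  have d1 : d 1 = b := by simp [hd]
  have d2 : d 2 = A := by simp [hd]
  have d3 : d 3 = n := by simp [hd]
  have hmon : C c * X 1 ^ b * X 2 ^ A * X 3 ^ n = monomial d c := by
    simp only [X_pow_eq_monomial, C_mul_monomial, monomial_mul, mul_one]
    congr 1
    rw [hd, add_comm (_ + _) (Finsupp.single 3 n), add_comm (Finsupp.single 1 b), ← add_assoc]
  have hX0 : ∀ e : Fin 4 →₀ ℕ, e 0 = 0 → coeff e (X 0 * Q) = 0 := by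
    intro e he
    have := coeff_mono_mul e 0 1 Q (by omega)
    rwa [pow_one] at this
  have hU : ∀ e : Fin 4 →₀ ℕ, e 2 ≤ A → coeff e (X 1 ^ b * (X 2 ^ (A + 1) * U)) = 0 := by
    intro e he
    rw [mul_left_comm]
    exact coeff_mono_mul e 2 (A + 1) _ (by omega)
  refine ⟨?_, ?_⟩
  · rw [h, coeff_add, coeff_add, coeff_add, hX0 d d0, coeff_mono_mul d 1 (b+1) W (by omega),
      hU d (by omega), hmon, coeff_monomial, if_pos rfl]
    simpa using hc
  · intro e he hne
    have hce : coeff e f ≠ 0 := mem_support_iff.1 he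
    have hdeg : ∑ i : Fin 4, e i = n + A + b := by
      have := hf hce
      rw [← this, Finsupp.weight_apply, Finsupp.sum_fintype _ _ (by simp)]
      simp
    have hdd : ∑ i : Fin 4, d i = n + A + b := by
      rw [Fin.sum_univ_four, d0, d1, d2, d3]; omega
    refine Or.inr ⟨hdeg.trans hdd.symm, ?_⟩
    by_cases e0 : e 0 = 0
    swap
    · exact ⟨0, by omega, by intro k hk; exact absurd hk (by simp)⟩
    rw [h, coeff_add, coeff_add, coeff_add, hX0 e e0, hmon, coeff_monomial,
      if_neg (Ne.symm hne)] at hce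
    by_cases e1 : b < e 1
    · refine ⟨1, by omega, ?_⟩
      intro k hk
      have : k = 0 := by omega
      subst this; omega
    rw [coeff_mono_mul e 1 (b+1) W (by omega)] at hce
    have e1' : e 1 = b := by
      by_contra hh
      apply hce
      rw [coeff_mono_mul e 1 b _ (by omega)]; simp
    have e2 : A < e 2 := by
      by_contra hh
      apply hce
      rw [hU e (by omega)]; simp
    refine ⟨2, by omega, ?_⟩
    intro k hk
    have : k = 0 ∨ k = 1 := by omega
    rcases this with rfl | rfl <;> omega

/-- for `p ≡ -1 (mod 3)` and `(2p-1)/3 ≤ j ≤ p-2`, the lead monomial of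
`tr_B^G(N^j · tr^P(a₃^{(5p-7)/3 - j} a₂²))` is `a₃^{pj} a₂^{(7p-5)/3 - 2j} a₁^{j-(2p-4)/3}`. -/
theorem phifamily (p : ℕ) [Fact p.Prime] (hp : 3 < p) (hp3 : p % 3 = 2)
    (F : Type) [Field F] [CharP F p] (j : ℕ)
    (hj : (2 * p - 1) / 3 ≤ j) (hj' : j ≤ p - 2) :
    LeadMonomialIs
      (trBG p F (Npoly p F ^ j * trP p F (X 3 ^ ((5 * p - 7) / 3 - j) * X 2 ^ 2)))
      (Finsupp.single 3 (p * j) + Finsupp.single 2 ((7 * p - 5) / 3 - 2 * j) +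
        Finsupp.single 1 (j - (2 * p - 4) / 3)) := by
  have hpp := (Fact.out : p.Prime)
  obtain ⟨m, hm⟩ : ∃ m, m = (5 * p - 7) / 3 - j := ⟨_, rfl⟩
  obtain ⟨b, hb⟩ : ∃ b, b = j - (2 * p - 4) / 3 := ⟨_, rfl⟩
  rw [← hm, ← hb]
  have hmb : m + b = p - 1 := by omega
  have hbm : b ≤ m := by omega
  have hA : (7 * p - 5) / 3 - 2 * j = m + 2 - b := by omega
  rw [hA]
  obtain ⟨Q, R, hT⟩ := T_mod p F m b hmb hbm
  obtain ⟨U, hN⟩ := N_mod p F j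
  obtain ⟨Z, hZ⟩ := trBG_mod p F j (by omega) (trP p F (X 3 ^ m * X 2 ^ 2))
  have hc := aux_c hp F m b hmb hbm (by omega)
  have hh := big_hom p F j m
  generalize - ((3 : F) ^ m * (4 * ((m + 2).choose b : F) - 4 * ((m + 1).choose b : F)
        + (m.choose b : F))) = c at hc hT
  refine lead_of _ (Z + X 3 ^ (p * j) * Q + U 0 * (C c * X 1 ^ b * X 2 ^ (m + 2 - b) + X 0 * Q
      + X 1 ^ (b + 1) * R) + (X 1 * U 1 + X 2 * U 2) * Q)
    (X 3 ^ (p * j) * R + U 1 * (C c * X 2 ^ (m + 2 - b)) + (X 1 * U 1 + X 2 * U 2) * R)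
    (C c * U 2) c hc _ _ _ ?_ ?_
  · rw [show p * j + (m + 2 - b) + b = p * j + (m + 2) by omega]
    exact hh
  · rw [sub_eq_iff_eq_add.1 hZ, hT, hN]
    ring

end
end

section
/- Define r_1 = K·e − D·tr^P(a3^{p−2}), r_2 = K·r_1 − (3D)^{(p−1)/2}·e, and r_i = K·r_{i−1} − (3D)^{(p−1)/2}·r_{i−2} for i ≥ 3. Then for every i ≥ 1, r_i ≡ 2 a1^{p+2+(i−1)(p−1)} modulo the ideal generated by a0. -/
open MvPolynomial

noncomputable section

/-- The sequence `rseq 0 = e` (auxiliary), `rseq 1 = r₁ = K·e - D·tr^P(a₃^{p-2})`, and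
`rseq i = r_i = K·r_{i-1} - (3D)^{(p-1)/2}·r_{i-2}` for `i ≥ 2` (note that
`r₂ = K·r₁ - (3D)^{(p-1)/2}·e` is the case `i = 2`). -/
def rseq (p : ℕ) [Fact p.Prime] (F : Type) [Field F] [CharP F p] :
    ℕ → MvPolynomial (Fin 4) F
  | 0 => epoly F
  | 1 => Kpoly p F * epoly F - Dpoly F * trP p F (X 3 ^ (p - 2))
  | (n + 2) => Kpoly p F * rseq p F (n + 1) - (3 * Dpoly F) ^ ((p - 1) / 2) * rseq p F n

section helpers

variable {p : ℕ} [Fact p.Prime] {R : Type*} [CommRing R]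

lemma h_cast_zero (ι : ZMod p →+* R) : (p : R) = 0 := by
  have := map_natCast ι p
  rw [← this]; simp

lemma h_choose (ι : ZMod p →+* R) (k : ℕ) (hk : k ≤ p - 1) :
    ((p - 1).choose k : R) = (-1) ^ k := by
  have hp : p.Prime := Fact.out
  induction k with
  | zero => simp
  | succ k ih =>
    have h1 := ih (by omega)
    have h2 : p.choose (k + 1) = (p - 1).choose k + (p - 1).choose (k + 1) := by
      conv_lhs => rw [← Nat.sub_add_cancel hp.one_lt.le]
      rw [Nat.choose_succ_succ]
    have h3 : (p.choose (k + 1) : R) = 0 := by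
      obtain ⟨m, hm⟩ := hp.dvd_choose_self (k := k + 1) (by omega) (by omega)
      rw [hm]; push_cast; rw [h_cast_zero ι]; simp
    rw [h2] at h3
    push_cast at h3
    rw [h1] at h3
    rw [pow_succ]
    linear_combination h3

lemma h_sub_pow (ι : ZMod p →+* R) (x y : R) :
    (x - y) ^ (p - 1) = ∑ k ∈ Finset.range p, x ^ k * y ^ (p - 1 - k) := by
  have hp : p.Prime := Fact.out
  have key : (-1 : R) ^ (p - 1) = 1 := by
    have := h_choose ι (p - 1) le_rfl
    simpa using this.symm
  rw [sub_eq_add_neg, add_pow, Nat.sub_add_cancel hp.one_lt.le]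
  refine Finset.sum_congr rfl fun k hk => ?_
  have hk' : k ≤ p - 1 := by
    have := Finset.mem_range.1 hk
    omega
  rw [h_choose ι k hk', neg_pow y]
  have : (-1 : R) ^ (p - 1 - k) * (-1) ^ k = 1 := by
    rw [← pow_add, Nat.sub_add_cancel hk', key]
  linear_combination (x ^ k * y ^ (p - 1 - k)) * this

lemma h_psum (ι : ZMod p →+* R) (i : ℕ) :
    ∑ s : ZMod p, (ι s) ^ i = if 0 < i ∧ (p - 1) ∣ i then -1 else 0 := by
  have hp : p.Prime := Fact.out
  have h : ∑ s : ZMod p, s ^ i = if 0 < i ∧ (p - 1) ∣ i then -1 else 0 := by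
    rcases Nat.eq_zero_or_pos i with rfl | hi
    · simp
    · have h1 := FiniteField.sum_pow_units (ZMod p) i
      rw [ZMod.card] at h1
      simp only [hi, true_and]
      rw [← h1]
      rw [← Finset.sum_subset (Finset.subset_univ (Finset.univ.filter fun x : ZMod p => x ≠ 0))]
      · symm
        refine Finset.sum_bij (fun (u : (ZMod p)ˣ) _ => (u : ZMod p)) ?_ ?_ ?_ ?_
        · intro a _; simp
        · intro a _ b _ hab; exact Units.ext hab
        · intro b hb
          have : b ≠ 0 := by simpa using hb
          exact ⟨Units.mk0 b this, Finset.mem_univ _, rfl⟩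
        · intro a _; rfl
      · intro x _ hx
        have : x = 0 := by simpa using hx
        rw [this, zero_pow hi.ne']
  have h2 := congrArg ι h
  rw [map_sum] at h2
  simp only [map_pow] at h2
  rw [h2]
  split_ifs <;> simp

/-- power sums of affine functions -/
lemma h_msum (ι : ZMod p →+* R) (a b : R) (j : ℕ) (hj : j ≤ 2 * (p - 1)) :
    ∑ s : ZMod p, (ι s * a + b) ^ j =
      if j = p - 1 then - a ^ (p - 1) else if j = 2 * (p - 1) then - a ^ (2 * (p - 1)) else 0 := by
  have hp : p.Prime := Fact.out
  have hp2 := hp.two_le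
  have h1 : ∑ s : ZMod p, (ι s * a + b) ^ j =
      ∑ i ∈ Finset.range (j + 1), (if 0 < i ∧ (p - 1) ∣ i then -1 else 0) *
        (a ^ i * b ^ (j - i) * (j.choose i : R)) := by
    simp only [add_pow, mul_pow]
    rw [Finset.sum_comm]
    refine Finset.sum_congr rfl fun i _ => ?_
    rw [← h_psum ι i, Finset.sum_mul]
    refine Finset.sum_congr rfl fun s _ => by ring
  rw [h1]
  have hdiv : ∀ i ≤ j, 0 < i → (p - 1) ∣ i → i = p - 1 ∨ i = 2 * (p - 1) := by
    rintro i hij hi ⟨m, rfl⟩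
    have : m ≤ 2 := by
      by_contra hm
      push Not at hm
      have : (p - 1) * 3 ≤ (p - 1) * m := Nat.mul_le_mul_left _ hm
      omega
    interval_cases m
    · simp at hi
    · left; simp
    · right; ring
  have hmid : p - 1 < j → (p.Prime) → j < 2 * (p - 1) ∨ j = 2 * (p - 1) → 
      (j.choose (p - 1) : R) = 0 := by
    intro h3 _ _
    obtain ⟨m, hm⟩ := hp.dvd_choose (a := p - 1) (b := j) (by omega) (by omega) (by omega)
    rw [hm]; push_cast; rw [h_cast_zero ι]; simp
  split_ifs with hA hB
  · subst hA
    rw [Finset.sum_eq_single (p - 1)]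
    · have : 0 < p - 1 := by omega
      simp [this]
    · intro i hi hne
      have hi' := Finset.mem_range.1 hi
      rw [if_neg, zero_mul]
      rintro ⟨h0, hd⟩
      rcases hdiv i (by omega) h0 hd with h | h <;> omega
    · intro h; exact absurd (Finset.mem_range.2 (by omega)) h
  · rw [Finset.sum_eq_single (2 * (p - 1))]
    · have : 0 < p - 1 := by omega
      simp [this, hB]
    · intro i hi hne
      have hi' := Finset.mem_range.1 hi
      by_cases hc : 0 < i ∧ (p - 1) ∣ i
      · rcases hdiv i (by omega) hc.1 hc.2 with h | h
        · rw [h, hmid (by omega) hp (by omega)]; simp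
        · omega
      · rw [if_neg hc, zero_mul]
    · intro h; exact absurd (Finset.mem_range.2 (by omega)) h
  · refine Finset.sum_eq_zero fun i hi => ?_
    have hi' := Finset.mem_range.1 hi
    by_cases hc : 0 < i ∧ (p - 1) ∣ i
    · rcases hdiv i (by omega) hc.1 hc.2 with h | h
      · rw [h, hmid (by omega) hp (by omega)]; simp
      · omega
    · rw [if_neg hc, zero_mul]

lemma h_pow_one (ι : ZMod p →+* R) (c : ZMod p) (hc : c ≠ 0) : (ι c) ^ (p - 1) = 1 := by
  rw [← map_pow, ZMod.pow_card_sub_one_eq_one hc, map_one]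

/-- the quadratic power sum -/
lemma h_qsum [IsDomain R] (hp3 : 3 < p) (ι : ZMod p →+* R) (A B C : R) (hA : A ≠ 0) :
    ∑ s : ZMod p, (A * ι s ^ 2 + B * ι s + C) ^ (p - 1) =
      - A ^ (p - 1) - (B ^ 2 - 4 * A * C) ^ ((p - 1) / 2) := by
  have hp : p.Prime := Fact.out
  have hodd : p % 2 = 1 := hp.eq_two_or_odd.resolve_left (by omega)
  have h2 : (2 : ZMod p) ≠ 0 := by
    intro h
    have : ((2 : ℕ) : ZMod p) = 0 := by exact_mod_cast h
    rw [ZMod.natCast_eq_zero_iff] at this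
    have := Nat.le_of_dvd (by norm_num) this
    omega
  have h2R : (2 : R) ^ (p - 1) = 1 := by
    have := h_pow_one ι 2 h2
    rwa [map_ofNat] at this
  have h2R0 : (2 : R) ≠ 0 := by
    intro h
    rw [h, zero_pow (by omega)] at h2R
    exact zero_ne_one h2R
  set Δ := B ^ 2 - 4 * A * C with hΔ
  have e1 : ∀ s : ZMod p, (4 * A) ^ (p - 1) * (A * ι s ^ 2 + B * ι s + C) ^ (p - 1) =
      ∑ k ∈ Finset.range p, Δ ^ (p - 1 - k) * (ι s * (2 * A) + B) ^ (2 * k) := by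
    intro s
    rw [← mul_pow]
    have : 4 * A * (A * ι s ^ 2 + B * ι s + C) = (ι s * (2 * A) + B) ^ 2 - Δ := by
      rw [hΔ]; ring
    rw [this, h_sub_pow ι]
    refine Finset.sum_congr rfl fun k _ => ?_
    rw [← pow_mul]; ring
  have e2 : (4 * A) ^ (p - 1) * ∑ s : ZMod p, (A * ι s ^ 2 + B * ι s + C) ^ (p - 1) =
      - (2 * A) ^ (p - 1) * Δ ^ ((p - 1) / 2) - (2 * A) ^ (2 * (p - 1)) := by
    rw [Finset.mul_sum, Finset.sum_congr rfl fun s _ => e1 s, Finset.sum_comm]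
    have e3 : ∀ k ∈ Finset.range p,
        ∑ s : ZMod p, Δ ^ (p - 1 - k) * (ι s * (2 * A) + B) ^ (2 * k) =
        (if k = (p - 1) / 2 then - (2 * A) ^ (p - 1) * Δ ^ ((p - 1) / 2) else 0) +
        (if k = p - 1 then - (2 * A) ^ (2 * (p - 1)) else 0) := by
      intro k hk
      have hk' := Finset.mem_range.1 hk
      rw [← Finset.mul_sum, h_msum ι _ _ _ (by omega)]
      by_cases c1 : k = (p - 1) / 2
      · have d1 : 2 * k = p - 1 := by omega
        have d2 : k ≠ p - 1 := by omega
        have d3 : p - 1 - k = (p - 1) / 2 := by omega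
        rw [if_pos d1, if_pos c1, if_neg d2, d3]; ring
      · have d1 : 2 * k ≠ p - 1 := by omega
        by_cases c2 : k = p - 1
        · rw [if_neg d1, if_neg c1, if_pos c2, if_pos (by omega), c2]; simp
        · rw [if_neg d1, if_neg c1, if_neg c2, if_neg (by omega)]; simp
    rw [Finset.sum_congr rfl e3, Finset.sum_add_distrib, Finset.sum_ite_eq', Finset.sum_ite_eq',
      if_pos (Finset.mem_range.2 (by omega)), if_pos (Finset.mem_range.2 (by omega))]
    ring
  have e4 : (4 * A) ^ (p - 1) = A ^ (p - 1) := by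
    rw [show (4 : R) = 2 * 2 by norm_num, mul_pow, mul_pow, h2R]; ring
  have e5 : (2 * A) ^ (p - 1) = A ^ (p - 1) := by
    rw [mul_pow, h2R, one_mul]
  rw [e4, mul_comm 2 (p - 1), pow_mul, e5] at e2
  apply mul_left_cancel₀ (pow_ne_zero (p - 1) hA)
  rw [e2]; ring

/-- elements of SL2 with nonzero lower-left entry -/
def hmat1 (x : (ZMod p)ˣ × ZMod p × ZMod p) : Matrix.SpecialLinearGroup (Fin 2) (ZMod p) :=
  ⟨!![x.2.2 * ((x.1⁻¹ : (ZMod p)ˣ) : ZMod p),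
      (x.2.2 * x.2.1 - 1) * ((x.1⁻¹ : (ZMod p)ˣ) : ZMod p); (x.1 : ZMod p), x.1 * x.2.1], by
    rw [Matrix.det_fin_two_of]
    have := x.1.inv_mul
    linear_combination this⟩

/-- elements of SL2 with zero lower-left entry -/
def hmat0 (x : (ZMod p)ˣ × ZMod p) : Matrix.SpecialLinearGroup (Fin 2) (ZMod p) :=
  ⟨!![((x.1⁻¹ : (ZMod p)ˣ) : ZMod p), x.2; 0, (x.1 : ZMod p)], by
    rw [Matrix.det_fin_two_of]
    have := x.1.inv_mul
    linear_combination this⟩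

lemma h_sl_sum {M : Type*} [AddCommMonoid M]
    (f : Matrix.SpecialLinearGroup (Fin 2) (ZMod p) → M) :
    ∑ g, f g = ∑ x : (ZMod p)ˣ × ZMod p, f (hmat0 x) +
      ∑ x : (ZMod p)ˣ × ZMod p × ZMod p, f (hmat1 x) := by
  classical
  rw [← Finset.sum_filter_add_sum_filter_not Finset.univ
    (fun g : Matrix.SpecialLinearGroup (Fin 2) (ZMod p) => g.1 1 0 = 0)]
  congr 1
  · symm
    refine Finset.sum_bij (fun x _ => hmat0 x) ?_ ?_ ?_ ?_
    · intro x _; rw [Finset.mem_filter]; refine ⟨Finset.mem_univ _, ?_⟩; simp [-ZMod.inv_coe_unit, hmat0]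
    · rintro ⟨d, b⟩ _ ⟨d', b'⟩ _ h
      have h1 := congrArg (fun g : Matrix.SpecialLinearGroup (Fin 2) (ZMod p) => g.1 1 1) h
      have h2 := congrArg (fun g : Matrix.SpecialLinearGroup (Fin 2) (ZMod p) => g.1 0 1) h
      simp [-ZMod.inv_coe_unit, hmat0] at h1 h2
      rw [Units.ext h1, h2]
    · intro g hg
      have hc : g.1 1 0 = 0 := by simpa using hg
      have hdet := g.2
      rw [Matrix.det_fin_two, hc, mul_zero, sub_zero] at hdet
      have hd : g.1 1 1 ≠ 0 := right_ne_zero_of_mul_eq_one hdet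
      refine ⟨(Units.mk0 _ hd, g.1 0 1), Finset.mem_univ _, ?_⟩
      apply Subtype.ext
      ext i j
      fin_cases i <;> fin_cases j <;> simp [-ZMod.inv_coe_unit, hmat0, hc]
      exact (eq_inv_of_mul_eq_one_left hdet).symm
    · intro x _; rfl
  · symm
    refine Finset.sum_bij (fun x _ => hmat1 x) ?_ ?_ ?_ ?_
    · intro x _; rw [Finset.mem_filter]; refine ⟨Finset.mem_univ _, ?_⟩; simp [-ZMod.inv_coe_unit, hmat1]
    · rintro ⟨c, u, w⟩ _ ⟨c', u', w'⟩ _ h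
      have h1 := congrArg (fun g : Matrix.SpecialLinearGroup (Fin 2) (ZMod p) => g.1 1 0) h
      have h2 := congrArg (fun g : Matrix.SpecialLinearGroup (Fin 2) (ZMod p) => g.1 1 1) h
      have h3 := congrArg (fun g : Matrix.SpecialLinearGroup (Fin 2) (ZMod p) => g.1 0 0) h
      simp [-ZMod.inv_coe_unit, hmat1] at h1
      obtain rfl := Units.ext h1
      simp [-ZMod.inv_coe_unit, hmat1] at h2 h3
      rw [h2, h3]
    · intro g hg
      have hc : g.1 1 0 ≠ 0 := by simpa using hg
      have hdet := g.2
      rw [Matrix.det_fin_two] at hdet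
      refine ⟨(Units.mk0 _ hc, g.1 1 1 * (g.1 1 0)⁻¹, g.1 0 0 * g.1 1 0), Finset.mem_univ _, ?_⟩
      apply Subtype.ext
      ext i j
      fin_cases i <;> fin_cases j <;> simp [-ZMod.inv_coe_unit, hmat1]
      · field_simp
      · field_simp
        linear_combination hdet
      · field_simp
    · intro x _; rfl

lemma h_trG (hp3 : 3 < p) (ι : ZMod p →+* R) (x1 x2 x3 : R) :
    ∑ g : Matrix.SpecialLinearGroup (Fin 2) (ZMod p),
      (ι (g.1 1 1 ^ 2 * g.1 0 0 + 2 * g.1 1 1 * g.1 0 1 * g.1 1 0) * x1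
        + ι (2 * g.1 1 1 * g.1 1 0 * g.1 0 0 + g.1 0 1 * g.1 1 0 ^ 2) * x2
        + ι (g.1 1 0 ^ 2 * g.1 0 0) * x3) ^ (p - 1) =
      ∑ u : ZMod p, (3 * x1 * ι u ^ 2 + 3 * x2 * ι u + x3) ^ (p - 1) := by
  rw [h_sl_sum]
  have z0 : ∑ x : (ZMod p)ˣ × ZMod p,
      (ι ((hmat0 x).1 1 1 ^ 2 * (hmat0 x).1 0 0
            + 2 * (hmat0 x).1 1 1 * (hmat0 x).1 0 1 * (hmat0 x).1 1 0) * x1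
        + ι (2 * (hmat0 x).1 1 1 * (hmat0 x).1 1 0 * (hmat0 x).1 0 0
            + (hmat0 x).1 0 1 * (hmat0 x).1 1 0 ^ 2) * x2
        + ι ((hmat0 x).1 1 0 ^ 2 * (hmat0 x).1 0 0) * x3) ^ (p - 1) = 0 := by
    rw [Fintype.sum_prod_type]
    refine Finset.sum_eq_zero fun d _ => ?_
    simp [-ZMod.inv_coe_unit, hmat0, h_cast_zero ι]
  have z1 : ∀ (c : (ZMod p)ˣ) (u w : ZMod p),
      (ι ((hmat1 (c, u, w)).1 1 1 ^ 2 * (hmat1 (c, u, w)).1 0 0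
            + 2 * (hmat1 (c, u, w)).1 1 1 * (hmat1 (c, u, w)).1 0 1 * (hmat1 (c, u, w)).1 1 0) * x1
        + ι (2 * (hmat1 (c, u, w)).1 1 1 * (hmat1 (c, u, w)).1 1 0 * (hmat1 (c, u, w)).1 0 0
            + (hmat1 (c, u, w)).1 0 1 * (hmat1 (c, u, w)).1 1 0 ^ 2) * x2
        + ι ((hmat1 (c, u, w)).1 1 0 ^ 2 * (hmat1 (c, u, w)).1 0 0) * x3) ^ (p - 1) =
      (ι w * (3 * x1 * ι u ^ 2 + 3 * x2 * ι u + x3) + -(2 * ι u * x1 + x2)) ^ (p - 1) := by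
    intro c u w
    rw [← one_mul ((ι w * (3 * x1 * ι u ^ 2 + 3 * x2 * ι u + x3) + -(2 * ι u * x1 + x2)) ^ (p - 1)),
      ← h_pow_one ι (c : ZMod p) c.ne_zero, ← mul_pow]
    congr 1
    have hc : ι (c : ZMod p) * ι ((c⁻¹ : (ZMod p)ˣ) : ZMod p) = 1 := by
      rw [← map_mul, c.mul_inv, map_one]
    simp only [hmat1, Matrix.of_apply, Matrix.cons_val', Matrix.cons_val_zero, Matrix.cons_val_one,
      Matrix.cons_val_fin_one, map_add, map_mul, map_pow, map_sub, map_one, map_ofNat]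
    generalize ι ((c⁻¹ : (ZMod p)ˣ) : ZMod p) = ci at hc
    generalize ι (c : ZMod p) = cc at hc
    generalize ι u = U
    generalize ι w = W
    linear_combination (cc * (U ^ 2 * W + 2 * U * (W * U - 1)) * x1
      + cc * (2 * U * W + (W * U - 1)) * x2 + cc * W * x3) * hc
  rw [z0, zero_add, Fintype.sum_prod_type]
  simp only [Fintype.sum_prod_type, z1]
  have z2 : ∀ u : ZMod p, ∑ w : ZMod p,
      (ι w * (3 * x1 * ι u ^ 2 + 3 * x2 * ι u + x3) + -(2 * ι u * x1 + x2)) ^ (p - 1) =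
      - (3 * x1 * ι u ^ 2 + 3 * x2 * ι u + x3) ^ (p - 1) := by
    intro u
    rw [h_msum ι _ _ _ (by omega), if_pos rfl]
  simp only [z2]
  rw [Finset.sum_const, Finset.card_univ, ZMod.card_units_eq_totient,
    Nat.totient_prime Fact.out, nsmul_eq_mul, Nat.cast_sub (by omega), h_cast_zero ι,
    Finset.sum_neg_distrib]
  simp

end helpers

section main

variable (p : ℕ) [Fact p.Prime] (F : Type) [Field F] [CharP F p]

/-- the prime field inside the polynomial ring -/
def hbaseHom : ZMod p →+* MvPolynomial (Fin 4) F := (C).comp (ZMod.castHom (dvd_refl p) F)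

/-- reduction modulo `a₀` -/
def hpi : MvPolynomial (Fin 4) F →+*
    (MvPolynomial (Fin 4) F ⧸ Ideal.span {(X 0 : MvPolynomial (Fin 4) F)}) :=
  Ideal.Quotient.mk _

lemma hpi_zero (f : MvPolynomial (Fin 4) F) : hpi F f = 0 ↔ X 0 ∣ f := by
  rw [hpi, Ideal.Quotient.eq_zero_iff_mem, Ideal.mem_span_singleton]

lemma hpi_X0 : hpi F (X 0) = 0 := (hpi_zero F _).2 dvd_rfl

lemma h_three (hp3 : 3 < p) : (3 : ZMod p) ≠ 0 := by
  intro h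
  have : ((3 : ℕ) : ZMod p) = 0 := by exact_mod_cast h
  rw [ZMod.natCast_eq_zero_iff] at this
  have := Nat.le_of_dvd (by norm_num) this
  omega

lemma h_three_pow (hp3 : 3 < p) : (3 : MvPolynomial (Fin 4) F) ^ (p - 1) = 1 := by
  have := h_pow_one (hbaseHom p F) 3 (h_three p hp3)
  rwa [map_ofNat] at this

lemma h_three_ne (hp3 : 3 < p) : (3 : MvPolynomial (Fin 4) F) ≠ 0 := by
  intro h
  have := h_three_pow p F hp3
  rw [h, zero_pow (by omega)] at this
  exact zero_ne_one this

/-- identity (A) -/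
lemma h_A (hp3 : 3 < p) :
    ∑ s : ZMod p, (3 * X 1 * hbaseHom p F s ^ 2 + 3 * X 2 * hbaseHom p F s + X 3) ^ (p - 1) =
      - X 1 ^ (p - 1) - (3 * xipoly F) ^ ((p - 1) / 2) := by
  rw [h_qsum hp3 (hbaseHom p F) _ _ _ (mul_ne_zero (h_three_ne p F hp3) (X_ne_zero 1)), mul_pow,
    h_three_pow p F hp3, xipoly]
  congr 2
  · ring
  · ring

/-- identity (B) -/
lemma h_B (hp3 : 3 < p) :
    xipoly F * ∑ s : ZMod p, (3 * X 1 * hbaseHom p F s ^ 2 + 3 * X 2 * hbaseHom p F s + X 3) ^ (p - 2) =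
      2 * X 1 * (3 * xipoly F) ^ ((p - 1) / 2) := by
  have hp : p.Prime := Fact.out
  have hodd : p % 2 = 1 := hp.eq_two_or_odd.resolve_left (by omega)
  obtain ⟨m, hm⟩ : ∃ m, (p - 1) / 2 = m + 1 := ⟨(p - 1) / 2 - 1, by omega⟩
  have hpm : p = 2 * m + 3 := by omega
  have hp0 : (p : MvPolynomial (Fin 4) F) = 0 := h_cast_zero (hbaseHom p F)
  have c1 : ((p - 1 : ℕ) : MvPolynomial (Fin 4) F) = -1 := by
    rw [Nat.cast_sub (by omega), hp0]; simp
  have c2 : (2 * m + 2 : MvPolynomial (Fin 4) F) = -1 := by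
    rw [hpm] at hp0; push_cast at hp0; linear_combination hp0
  have h := congrArg (pderiv (R := F) (3 : Fin 4)) (h_A p F hp3)
  have hs : ∀ s : ZMod p, pderiv (R := F) (3 : Fin 4)
      ((3 * X 1 * hbaseHom p F s ^ 2 + 3 * X 2 * hbaseHom p F s + X 3) ^ (p - 1)) =
      - (3 * X 1 * hbaseHom p F s ^ 2 + 3 * X 2 * hbaseHom p F s + X 3) ^ (p - 2) := by
    intro s
    have t : pderiv (R := F) (3 : Fin 4)
        (3 * X 1 * hbaseHom p F s ^ 2 + 3 * X 2 * hbaseHom p F s + X 3) = 1 := by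
      have h3 : (3 : MvPolynomial (Fin 4) F) = C 3 := (map_ofNat C 3).symm
      simp only [hbaseHom, RingHom.comp_apply, h3, ← C_pow]
      simp [pderiv_X, Derivation.leibniz]
    rw [Derivation.leibniz_pow, t, show p - 1 - 1 = p - 2 by omega]
    simp [c1]
  have hx : pderiv (R := F) (3 : Fin 4) (3 * xipoly F) = - 12 * X 1 := by
    have h3 : (3 : MvPolynomial (Fin 4) F) = C 3 := (map_ofNat C 3).symm
    have h4 : (4 : MvPolynomial (Fin 4) F) = C 4 := (map_ofNat C 4).symm
    have h12 : (12 : MvPolynomial (Fin 4) F) = C 3 * C 4 := by rw [← h3, ← h4]; norm_num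
    simp only [xipoly, h3, h4, h12]
    simp [pderiv_X, Derivation.leibniz]
    ring
  rw [map_sum, Finset.sum_congr rfl fun s _ => hs s, Finset.sum_neg_distrib, map_sub, map_neg,
    Derivation.leibniz_pow, Derivation.leibniz_pow, hx, hm, pderiv_X_of_ne (by decide)] at h
  simp only [smul_zero, nsmul_eq_mul, smul_eq_mul, Nat.add_sub_cancel] at h
  rw [hm]
  push_cast at h
  generalize (∑ s : ZMod p, (3 * X 1 * hbaseHom p F s ^ 2 + 3 * X 2 * hbaseHom p F s + X 3) ^ (p - 2)) = T at *
  rw [pow_succ]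
  linear_combination (-xipoly F) * h + (-6 * xipoly F * X 1 * (3 * xipoly F) ^ m) * c2

lemma hpi_K (hp3 : 3 < p) :
    hpi F (Kpoly p F) = hpi F (X 1) ^ (p - 1) + (3 * hpi F (xipoly F)) ^ ((p - 1) / 2) := by
  have h1 := congrArg (hpi F) (h_A p F hp3)
  have h2 := h_trG hp3 ((hpi F).comp (hbaseHom p F)) (hpi F (X 1)) (hpi F (X 2)) (hpi F (X 3))
  have h3 : hpi F (trG p F (X 1 ^ (p - 1))) =
      ∑ u : ZMod p, (3 * hpi F (X 1) * hpi F (hbaseHom p F u) ^ 2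
        + 3 * hpi F (X 2) * hpi F (hbaseHom p F u) + hpi F (X 3)) ^ (p - 1) := by
    simp only [RingHom.comp_apply] at h2
    rw [← h2, trG, map_sum]
    refine Finset.sum_congr rfl fun g _ => ?_
    rw [map_pow, map_pow]
    congr 1
    simp only [act, aeval_X, Matrix.cons_val_one, Matrix.cons_val_zero, map_add, map_mul, map_pow,
      hpi_X0, map_ofNat, hbaseHom, RingHom.comp_apply]
    ring
  simp only [map_sum, map_pow, map_add, map_sub, map_neg, map_mul, map_ofNat] at h1
  rw [Kpoly, map_neg, h3, h1]
  ring

lemma hpi_D : hpi F (Dpoly F) = hpi F (X 1) ^ 2 * hpi F (xipoly F) := by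
  simp only [Dpoly, xipoly, map_add, map_sub, map_mul, map_pow, map_ofNat, hpi_X0]
  ring

lemma hpi_e : hpi F (epoly F) = 2 * hpi F (X 1) ^ 3 := by
  simp only [epoly, map_add, map_sub, map_mul, map_pow, map_ofNat, hpi_X0]
  ring

lemma hpi_trP (hp3 : 3 < p) :
    hpi F (xipoly F) * hpi F (trP p F (X 3 ^ (p - 2))) =
      2 * hpi F (X 1) * (3 * hpi F (xipoly F)) ^ ((p - 1) / 2) := by
  have h1 := congrArg (hpi F) (h_B p F hp3)
  simp only [map_sum, map_pow, map_add, map_sub, map_neg, map_mul, map_ofNat] at h1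
  rw [← h1, trP, map_sum]
  congr 1
  refine Finset.sum_congr rfl fun s _ => ?_
  rw [map_pow, map_pow]
  congr 1
  simp [act, hpi_X0, hbaseHom]
  simp only [map_ofNat]
  ring

lemma hpi_r (hp3 : 3 < p) (i : ℕ) :
    hpi F (rseq p F i) = 2 * hpi F (X 1) ^ (3 + i * (p - 1)) ∧
    hpi F (rseq p F (i + 1)) = 2 * hpi F (X 1) ^ (3 + (i + 1) * (p - 1)) := by
  have hp : p.Prime := Fact.out
  have hodd : p % 2 = 1 := hp.eq_two_or_odd.resolve_left (by omega)
  induction i with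
  | zero =>
    refine ⟨by simp [rseq, hpi_e], ?_⟩
    have h := hpi_trP p F hp3
    simp only [zero_add, rseq, map_sub, map_mul, hpi_K p F hp3, hpi_D, hpi_e, one_mul, pow_add]
    linear_combination (-hpi F (X 1) ^ 2) * h
  | succ i ih =>
    refine ⟨ih.2, ?_⟩
    have e : (hpi F (X 1) ^ 2) ^ ((p - 1) / 2) = hpi F (X 1) ^ (p - 1) := by
      rw [← pow_mul]; congr 1; omega
    have e3 : (3 * (hpi F (X 1) ^ 2 * hpi F (xipoly F))) ^ ((p - 1) / 2) =
        hpi F (X 1) ^ (p - 1) * (3 * hpi F (xipoly F)) ^ ((p - 1) / 2) := by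
      rw [← e, ← mul_pow]; congr 1; ring
    rw [rseq, map_sub, map_mul, map_mul, ih.1, ih.2, hpi_K p F hp3, map_pow, map_mul, hpi_D,
      map_ofNat, e3]
    ring

end main

/-- for every `i ≥ 1`, `r_i ≡ 2 a₁^{p+2+(i-1)(p-1)}` modulo the
ideal `(a₀)`. -/
theorem rseq_mod_a0 (p : ℕ) [Fact p.Prime] (hp : 3 < p)
    (F : Type) [Field F] [CharP F p] (i : ℕ) (hi : 1 ≤ i) :
    X 0 ∣ (rseq p F i - 2 * X 1 ^ (p + 2 + (i - 1) * (p - 1))) := by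
  rw [← hpi_zero]
  obtain ⟨j, rfl⟩ : ∃ j, i = j + 1 := ⟨i - 1, by omega⟩
  have h := (hpi_r p F hp j).2
  have e : p + 2 + (j + 1 - 1) * (p - 1) = 3 + (j + 1) * (p - 1) := by
    rw [Nat.add_sub_cancel, add_mul]; omega
  rw [e, map_sub, h, map_mul, map_pow, map_ofNat, sub_self]

end
end
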